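/- Let A = B/I be the DGA of the elliptic arrangement as above, with its second ('weight') grading in which x_i, y_i are assigned bidegree (cohomological 1, weight 1) and g_i bidegree (cohomological 1, weight 2); then the differential d is homogeneous of cohomological degree +1 and weight 0, and the two-variable Hilbert series of H*(A,d) is H(t,u) = 1 + 4tu + 3t²u² + 2t²u³. -/

import Mathlib

open ExteriorAlgebra

/-- `B`, the exterior algebra over `ℚ` on the seven generators
`x₁, y₁, x₂, y₂, g₁, g₂, g₃` (indices `0,…,6`). -/
noncomputable abbrev Lam7 : Type := ExteriorAlgebra ℚ (Fin 7 → ℚ)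

/-- The generators: `e7 0 = x₁`, `e7 1 = y₁`, `e7 2 = x₂`, `e7 3 = y₂`,
`e7 4 = g₁`, `e7 5 = g₂`, `e7 6 = g₃`. -/
noncomputable def e7 (i : Fin 7) : Lam7 := ExteriorAlgebra.ι ℚ (Pi.single i 1)

/-- The defining relations of the DGA of the elliptic arrangement
`{ker α₁, ker α₂, ker (α₁ − α₂)}` in `E²`:
`g₂g₃ − g₁g₃ + g₁g₂`, `x₁g₁`, `y₁g₁`, `x₂g₂`, `y₂g₂`, `(x₁−x₂)g₃`, `(y₁−y₂)g₃`. -/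
noncomputable def rels7 : Set Lam7 :=
  { e7 5 * e7 6 - e7 4 * e7 6 + e7 4 * e7 5,
    e7 0 * e7 4, e7 1 * e7 4, e7 2 * e7 5, e7 3 * e7 5,
    (e7 0 - e7 2) * e7 6, (e7 1 - e7 3) * e7 6 }

/-- The two-sided ideal `I` generated by the relations, as a `ℚ`-submodule. -/
noncomputable def idl7 : Submodule ℚ Lam7 :=
  Submodule.span ℚ {x | ∃ a b r : Lam7, r ∈ rels7 ∧ x = a * r * b}

/-- The grading (parity) involution of the exterior algebra, negating each
degree-one generator. -/
noncomputable def sigma7 : Lam7 →ₐ[ℚ] Lam7 := CliffordAlgebra.involute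

/-- `d` is the graded derivation of `B` determined by `dxᵢ = dyᵢ = 0`,
`dg₁ = x₁y₁`, `dg₂ = x₂y₂`, `dg₃ = x₁y₁ − x₁y₂ − x₂y₁ + x₂y₂`:
it satisfies the graded Leibniz rule `d(ab) = (da)b + σ(a)(db)` (with `σ` the
parity involution) and takes the prescribed values on the generators. -/
def IsDiff7 (d : Lam7 →ₗ[ℚ] Lam7) : Prop :=
  (∀ a b : Lam7, d (a * b) = d a * b + sigma7 a * d b) ∧
  d (e7 0) = 0 ∧ d (e7 1) = 0 ∧ d (e7 2) = 0 ∧ d (e7 3) = 0 ∧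
  d (e7 4) = e7 0 * e7 1 ∧
  d (e7 5) = e7 2 * e7 3 ∧
  d (e7 6) = e7 0 * e7 1 - e7 0 * e7 3 - e7 2 * e7 1 + e7 2 * e7 3

/-- The differential induced by `d` on the quotient `A = B/I`. -/
noncomputable def dbar7 (d : Lam7 →ₗ[ℚ] Lam7) (hdi : ∀ x ∈ idl7, d x ∈ idl7) :
    (Lam7 ⧸ idl7) →ₗ[ℚ] Lam7 ⧸ idl7 :=
  Submodule.mapQ idl7 idl7 d (fun x hx => hdi x hx)

/-- The weight of each generator: `x₁, y₁, x₂, y₂` have weight `1`;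
`g₁, g₂, g₃` have weight `2`. -/
def wt7 (i : Fin 7) : ℕ := if (i : ℕ) < 4 then 1 else 2

/-- The bigraded `(p, w)` piece of `B`: the span of products of `p` generators
of total weight `w` (cohomological degree `p`, weight `w`). -/
noncomputable def Bpw (p w : ℕ) : Submodule ℚ Lam7 :=
  Submodule.span ℚ
    {x | ∃ l : List (Fin 7), l.length = p ∧ (l.map wt7).sum = w ∧
      x = (l.map e7).prod}

/-- The bigraded `(p, w)` piece of `A = B/I`. -/
noncomputable def Apw (p w : ℕ) : Submodule ℚ (Lam7 ⧸ idl7) :=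
  Submodule.map idl7.mkQ (Bpw p w)

/-- The `(p, w)`-cocycles. -/
noncomputable def Zpw (d : Lam7 →ₗ[ℚ] Lam7) (hdi : ∀ x ∈ idl7, d x ∈ idl7)
    (p w : ℕ) : Submodule ℚ (Lam7 ⧸ idl7) :=
  Apw p w ⊓ LinearMap.ker (dbar7 d hdi)

/-- The `(p, w)`-coboundaries `d(A^{p-1, w})`. -/
noncomputable def Bdpw (d : Lam7 →ₗ[ℚ] Lam7) (hdi : ∀ x ∈ idl7, d x ∈ idl7) :
    ℕ → ℕ → Submodule ℚ (Lam7 ⧸ idl7)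
  | 0, _ => ⊥
  | (p + 1), w => Submodule.map (dbar7 d hdi) (Apw p w)

/-- `dim gr_w H^p(A, d)`, the bigraded cohomology dimension. -/
noncomputable def hdimpw (d : Lam7 →ₗ[ℚ] Lam7) (hdi : ∀ x ∈ idl7, d x ∈ idl7)
    (p w : ℕ) : ℕ :=
  Module.finrank ℚ
    (Zpw d hdi p w ⧸ Submodule.comap (Zpw d hdi p w).subtype (Bdpw d hdi p w))

/-! ### The quotient algebra -/

theorem e7_sq (i : Fin 7) : e7 i * e7 i = 0 := ι_sq_zero _

theorem e7_swap (i j : Fin 7) : e7 i * e7 j = -(e7 j * e7 i) :=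
  eq_neg_of_add_eq_zero_left (ι_add_mul_swap _ _)

theorem mul_mul_mem_idl7 (a b : Lam7) {x : Lam7} (hx : x ∈ idl7) : a * x * b ∈ idl7 := by
  unfold idl7 at hx
  induction hx using Submodule.span_induction with
  | mem x hx =>
    obtain ⟨a', b', r, hr, rfl⟩ := hx
    exact Submodule.subset_span ⟨a * a', b' * b, r, hr, by simp only [mul_assoc]⟩
  | zero => simp
  | add x y _ _ hx hy => rw [mul_add, add_mul]; exact add_mem hx hy
  | smul c x _ hx => rw [mul_smul_comm, smul_mul_assoc]; exact Submodule.smul_mem _ c hx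

theorem mem_idl7_of_mem_rels7 {r : Lam7} (hr : r ∈ rels7) : r ∈ idl7 :=
  Submodule.subset_span ⟨1, 1, r, hr, by simp⟩

/-- An algebra homomorphism killing the relations kills the ideal they generate. -/
theorem map_eq_zero_of_mem_idl7 {R : Type*} [Ring R] [Algebra ℚ R] (φ : Lam7 →ₐ[ℚ] R)
    (hφ : ∀ r ∈ rels7, φ r = 0) {x : Lam7} (hx : x ∈ idl7) : φ x = 0 := by
  have : idl7 ≤ LinearMap.ker φ.toLinearMap := by
    refine Submodule.span_le.2 ?_
    rintro _ ⟨a, b, r, hr, rfl⟩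
    simp [hφ r hr]
  exact this hx

/-- Congruence modulo the ideal of relations. -/
noncomputable def con7 : RingCon Lam7 where
  r a b := a - b ∈ idl7
  iseqv :=
    { refl := fun a => by simp
      symm := fun {a b} h => by simpa using neg_mem h
      trans := fun {a b c} h h' => by simpa using add_mem h h' }
  add' {a b c d} h h' := by
    have := add_mem h h'
    rwa [sub_add_sub_comm] at this
  mul' {a b c d} h h' := by
    have := add_mem (mul_mul_mem_idl7 1 c h) (mul_mul_mem_idl7 b 1 h')
    simpa [sub_mul, mul_sub] using this

/-- The algebra `A = B/I`. -/
abbrev Alg7 : Type := con7.Quotient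

/-- The quotient map `B → A`. -/
noncomputable def toAlg7 : Lam7 →ₐ[ℚ] Alg7 := con7.mkₐ ℚ

theorem toAlg7_eq_iff {a b : Lam7} : toAlg7 a = toAlg7 b ↔ a - b ∈ idl7 := RingCon.eq _

theorem toAlg7_eq_zero_iff {a : Lam7} : toAlg7 a = 0 ↔ a ∈ idl7 := by
  rw [← map_zero toAlg7, toAlg7_eq_iff, sub_zero]

/-- The images of the generators in `A`. -/
noncomputable def t7 (i : Fin 7) : Alg7 := toAlg7 (e7 i)

theorem toAlg7_e7 (i : Fin 7) : toAlg7 (e7 i) = t7 i := rfl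

theorem t7_sq (i : Fin 7) : t7 i * t7 i = 0 := by
  rw [t7, ← map_mul, e7_sq, map_zero]

theorem t7_sq_mul (i : Fin 7) (z : Alg7) : t7 i * (t7 i * z) = 0 := by
  rw [← mul_assoc, t7_sq, zero_mul]

theorem t7_swap (i j : Fin 7) : t7 i * t7 j = -(t7 j * t7 i) := by
  rw [t7, t7, ← map_mul, e7_swap, map_neg, map_mul]

theorem t7_swap_mul (i j : Fin 7) (z : Alg7) : t7 i * (t7 j * z) = -(t7 j * (t7 i * z)) := by
  rw [← mul_assoc, t7_swap, neg_mul, mul_assoc]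

theorem t7_swap_of_lt {i j : Fin 7} (_ : i < j) : t7 j * t7 i = -(t7 i * t7 j) := t7_swap j i

theorem t7_swap_mul_of_lt {i j : Fin 7} (_ : i < j) (z : Alg7) :
    t7 j * (t7 i * z) = -(t7 i * (t7 j * z)) := t7_swap_mul j i z

theorem toAlg7_eq_zero_of_mem_rels7 {r : Lam7} (hr : r ∈ rels7) : toAlg7 r = 0 :=
  toAlg7_eq_zero_iff.2 (mem_idl7_of_mem_rels7 hr)

theorem t7_zero_four : t7 0 * t7 4 = 0 := by
  simpa [toAlg7_e7] using toAlg7_eq_zero_of_mem_rels7 (r := e7 0 * e7 4) (by simp [rels7])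

theorem t7_one_four : t7 1 * t7 4 = 0 := by
  simpa [toAlg7_e7] using toAlg7_eq_zero_of_mem_rels7 (r := e7 1 * e7 4) (by simp [rels7])

theorem t7_two_five : t7 2 * t7 5 = 0 := by
  simpa [toAlg7_e7] using toAlg7_eq_zero_of_mem_rels7 (r := e7 2 * e7 5) (by simp [rels7])

theorem t7_three_five : t7 3 * t7 5 = 0 := by
  simpa [toAlg7_e7] using toAlg7_eq_zero_of_mem_rels7 (r := e7 3 * e7 5) (by simp [rels7])

theorem t7_two_six : t7 2 * t7 6 = t7 0 * t7 6 := by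
  have := toAlg7_eq_zero_of_mem_rels7 (r := (e7 0 - e7 2) * e7 6) (by simp [rels7])
  simp only [map_mul, map_sub, toAlg7_e7, sub_mul] at this
  exact (sub_eq_zero.1 this).symm

theorem t7_three_six : t7 3 * t7 6 = t7 1 * t7 6 := by
  have := toAlg7_eq_zero_of_mem_rels7 (r := (e7 1 - e7 3) * e7 6) (by simp [rels7])
  simp only [map_mul, map_sub, toAlg7_e7, sub_mul] at this
  exact (sub_eq_zero.1 this).symm

theorem t7_five_six : t7 5 * t7 6 = t7 4 * t7 6 - t7 4 * t7 5 := by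
  have := toAlg7_eq_zero_of_mem_rels7
    (r := e7 5 * e7 6 - e7 4 * e7 6 + e7 4 * e7 5) (by simp [rels7])
  simp only [map_mul, map_sub, map_add, toAlg7_e7] at this
  rw [← sub_eq_zero, ← this]
  abel

/-- `t i` annihilates `t j * z` as soon as it annihilates `z`. -/
theorem t7_mul_mul_eq_zero {i : Fin 7} {z : Alg7} (h : t7 i * z = 0) (j : Fin 7) :
    t7 i * (t7 j * z) = 0 := by
  rw [t7_swap_mul, h, mul_zero, neg_zero]

/-- `t i` and `t k` act alike on `t j * z` as soon as they act alike on `z`. -/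
theorem t7_mul_mul_congr {i k : Fin 7} {z : Alg7} (h : t7 i * z = t7 k * z) (j : Fin 7) :
    t7 i * (t7 j * z) = t7 k * (t7 j * z) := by
  rw [t7_swap_mul, h, ← t7_swap_mul]

/-! ### Spanning sets of the bigraded pieces -/

/-- The span in `A` of the classes `x₁, y₁, x₂, y₂`. -/
noncomputable def X7 : Submodule ℚ Alg7 := Submodule.span ℚ (Set.range ![t7 0, t7 1, t7 2, t7 3])

/-- The span in `A` of the classes `g₁, g₂, g₃`. -/
noncomputable def G7 : Submodule ℚ Alg7 := Submodule.span ℚ (Set.range ![t7 4, t7 5, t7 6])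

theorem commute_X7_G7 : G7 * X7 = X7 * G7 := by
  rw [X7, G7, Submodule.span_mul_span, Submodule.span_mul_span]
  have key : ∀ i : Fin 3, ∀ j : Fin 4, ![t7 4, t7 5, t7 6] i * ![t7 0, t7 1, t7 2, t7 3] j
      = -(![t7 0, t7 1, t7 2, t7 3] j * ![t7 4, t7 5, t7 6] i) := by
    intro i j
    fin_cases i <;> fin_cases j <;> exact t7_swap _ _
  apply le_antisymm
  · refine Submodule.span_le.2 ?_
    rintro _ ⟨_, ⟨i, rfl⟩, _, ⟨j, rfl⟩, rfl⟩
    simp only [SetLike.mem_coe]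
    rw [key i j]
    exact neg_mem (Submodule.subset_span (Set.mul_mem_mul ⟨j, rfl⟩ ⟨i, rfl⟩))
  · refine Submodule.span_le.2 ?_
    rintro _ ⟨_, ⟨j, rfl⟩, _, ⟨i, rfl⟩, rfl⟩
    simp only [SetLike.mem_coe]
    rw [← neg_eq_iff_eq_neg.2 (key i j)]
    exact neg_mem (Submodule.subset_span (Set.mul_mem_mul ⟨i, rfl⟩ ⟨j, rfl⟩))

theorem toAlg7_prod_mem (l : List (Fin 7)) :
    ∃ a b : ℕ, a + b = l.length ∧ a + 2 * b = (l.map wt7).sum ∧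
      toAlg7 (l.map e7).prod ∈ X7 ^ a * G7 ^ b := by
  induction l with
  | nil => exact ⟨0, 0, rfl, rfl, by
    simpa using (Submodule.one_le (P := (1 : Submodule ℚ Alg7))).1 le_rfl⟩
  | cons i l ih =>
    obtain ⟨a, b, hl, hw, hm⟩ := ih
    by_cases hi : (i : ℕ) < 4
    · have hX : t7 i ∈ X7 := Submodule.subset_span ⟨⟨i, hi⟩, by
        obtain ⟨i, hi'⟩ := i
        simp only at hi ⊢
        interval_cases i <;> rfl⟩
      refine ⟨a + 1, b, by simp; omega, by simp [wt7, hi, ← hw]; omega, ?_⟩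
      rw [List.map_cons, List.prod_cons, map_mul, toAlg7_e7, pow_succ', mul_assoc]
      exact Submodule.mul_mem_mul hX hm
    · have hG : t7 i ∈ G7 := Submodule.subset_span ⟨⟨i - 4, by omega⟩, by
        obtain ⟨i, hi'⟩ := i
        simp only at hi ⊢
        interval_cases i <;> rfl⟩
      refine ⟨a, b + 1, by simp; omega, by simp [wt7, hi, ← hw]; omega, ?_⟩
      have hc : Commute G7 (X7 ^ a) := Commute.pow_right commute_X7_G7 a
      rw [List.map_cons, List.prod_cons, map_mul, toAlg7_e7, pow_succ', ← mul_assoc, ← hc.eq,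
        mul_assoc]
      exact Submodule.mul_mem_mul hG hm

theorem span_range_mul_le {m n k : ℕ} {u : Fin m → Alg7} {v : Fin n → Alg7} {w : Fin k → Alg7}
    (h : ∀ i j, u i * v j ∈ Submodule.span ℚ (Set.range w)) :
    Submodule.span ℚ (Set.range u) * Submodule.span ℚ (Set.range v) ≤
      Submodule.span ℚ (Set.range w) := by
  rw [Submodule.span_mul_span]
  refine Submodule.span_le.2 ?_
  rintro _ ⟨_, ⟨i, rfl⟩, _, ⟨j, rfl⟩, rfl⟩
  exact h i j

theorem span_range_fin_zero : Submodule.span ℚ (Set.range (![] : Fin 0 → Alg7)) = ⊥ := by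
  simp

theorem X7_pow_two_le : X7 ^ 2 ≤ Submodule.span ℚ (Set.range ![t7 0 * t7 1, t7 0 * t7 2,
    t7 0 * t7 3, t7 1 * t7 2, t7 1 * t7 3, t7 2 * t7 3]) := by
  rw [sq, X7]
  refine span_range_mul_le fun i j => ?_
  fin_cases i <;> fin_cases j <;> simp [t7_swap_of_lt, t7_sq] <;>
    exact Submodule.subset_span (by simp)

theorem X7_pow_three_le : X7 ^ 3 ≤ Submodule.span ℚ (Set.range ![t7 0 * (t7 1 * t7 2),
    t7 0 * (t7 1 * t7 3), t7 0 * (t7 2 * t7 3), t7 1 * (t7 2 * t7 3)]) := by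
  rw [pow_succ']
  refine (mul_le_mul' le_rfl X7_pow_two_le).trans (span_range_mul_le fun i j => ?_)
  fin_cases i <;> fin_cases j <;>
    simp [t7_swap_of_lt, t7_swap_mul_of_lt, t7_sq, t7_sq_mul] <;>
    exact Submodule.subset_span (by simp)

theorem X7_pow_four_le :
    X7 ^ 4 ≤ Submodule.span ℚ (Set.range ![t7 0 * (t7 1 * (t7 2 * t7 3))]) := by
  rw [pow_succ']
  refine (mul_le_mul' le_rfl X7_pow_three_le).trans (span_range_mul_le fun i j => ?_)
  fin_cases i <;> fin_cases j <;>
    simp [t7_swap_of_lt, t7_swap_mul_of_lt, t7_sq, t7_sq_mul]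

theorem X7_pow_five : X7 ^ 5 = ⊥ := by
  rw [eq_bot_iff, ← span_range_fin_zero, pow_succ']
  refine (mul_le_mul' le_rfl X7_pow_four_le).trans (span_range_mul_le fun i j => ?_)
  fin_cases i <;> fin_cases j <;>
    simp [t7_swap_mul_of_lt, t7_sq, t7_sq_mul]

theorem X7_mul_G7_le : X7 * G7 ≤ Submodule.span ℚ (Set.range ![t7 2 * t7 4, t7 3 * t7 4,
    t7 0 * t7 5, t7 1 * t7 5, t7 0 * t7 6, t7 1 * t7 6]) := by
  rw [X7, G7]
  refine span_range_mul_le fun i j => ?_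
  fin_cases i <;> fin_cases j <;>
    simp [t7_zero_four, t7_one_four, t7_two_five, t7_three_five, t7_two_six, t7_three_six] <;>
    exact Submodule.subset_span (by simp)

theorem X7_pow_two_mul_G7_le : X7 ^ 2 * G7 ≤ Submodule.span ℚ (Set.range
    ![t7 2 * (t7 3 * t7 4), t7 0 * (t7 1 * t7 5), t7 0 * (t7 1 * t7 6)]) := by
  rw [pow_succ', pow_one, mul_assoc]
  refine (mul_le_mul' le_rfl X7_mul_G7_le).trans (span_range_mul_le fun i j => ?_)
  fin_cases i <;> fin_cases j <;>
    simp [t7_swap_mul_of_lt, t7_sq_mul, t7_mul_mul_eq_zero t7_zero_four,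
      t7_mul_mul_eq_zero t7_one_four, t7_mul_mul_eq_zero t7_two_five,
      t7_mul_mul_eq_zero t7_three_five, t7_mul_mul_congr t7_two_six,
      t7_mul_mul_congr t7_three_six] <;>
    exact Submodule.subset_span (by simp)

theorem X7_pow_three_mul_G7 : X7 ^ 3 * G7 = ⊥ := by
  rw [eq_bot_iff, ← span_range_fin_zero, pow_succ', mul_assoc]
  refine (mul_le_mul' le_rfl X7_pow_two_mul_G7_le).trans (span_range_mul_le fun i j => ?_)
  fin_cases i <;> fin_cases j <;>
    simp [t7_swap_mul_of_lt, t7_sq_mul, t7_mul_mul_eq_zero (t7_mul_mul_eq_zero t7_zero_four _),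
      t7_mul_mul_eq_zero (t7_mul_mul_eq_zero t7_one_four _),
      t7_mul_mul_eq_zero (t7_mul_mul_eq_zero t7_two_five _),
      t7_mul_mul_eq_zero (t7_mul_mul_eq_zero t7_three_five _),
      t7_mul_mul_congr (t7_mul_mul_congr t7_two_six _),
      t7_mul_mul_congr (t7_mul_mul_congr t7_three_six _)]

theorem G7_pow_two_le :
    G7 ^ 2 ≤ Submodule.span ℚ (Set.range ![t7 4 * t7 5, t7 4 * t7 6]) := by
  have h45 : t7 4 * t7 5 ∈ Submodule.span ℚ {t7 4 * t7 6, t7 4 * t7 5} :=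
    Submodule.subset_span (by simp)
  have h46 : t7 4 * t7 6 ∈ Submodule.span ℚ {t7 4 * t7 6, t7 4 * t7 5} :=
    Submodule.subset_span (by simp)
  rw [sq, G7]
  refine span_range_mul_le fun i j => ?_
  have h56 := sub_mem h46 h45
  fin_cases i <;> fin_cases j <;>
    simp [t7_swap_of_lt, t7_sq, t7_five_six, -neg_sub] <;>
    assumption

theorem X7_mul_G7_pow_two : X7 * G7 ^ 2 = ⊥ := by
  rw [eq_bot_iff, ← span_range_fin_zero]
  refine (mul_le_mul' le_rfl G7_pow_two_le).trans (span_range_mul_le fun i j => ?_)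
  have h4 : ∀ z, t7 4 * (t7 0 * z) = 0 := fun z => by
    rw [← mul_assoc, t7_swap, t7_zero_four, neg_zero, zero_mul]
  have h4' : ∀ z, t7 4 * (t7 1 * z) = 0 := fun z => by
    rw [← mul_assoc, t7_swap, t7_one_four, neg_zero, zero_mul]
  fin_cases i <;> fin_cases j <;>
    simp [t7_swap_mul _ 4, h4, h4', t7_two_five, t7_three_five, t7_two_six, t7_three_six]

theorem G7_pow_three : G7 ^ 3 = ⊥ := by
  rw [eq_bot_iff, ← span_range_fin_zero, pow_succ']
  refine (mul_le_mul' le_rfl G7_pow_two_le).trans (span_range_mul_le fun i j => ?_)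
  fin_cases i <;> fin_cases j <;>
    simp [t7_swap_of_lt, t7_swap_mul_of_lt, t7_sq, t7_sq_mul, t7_five_six, mul_sub]

theorem toAlg7_mem_of_mem_Bpw {a b : ℕ} {z : Lam7} (hz : z ∈ Bpw (a + b) (a + 2 * b)) :
    toAlg7 z ∈ X7 ^ a * G7 ^ b := by
  have : Bpw (a + b) (a + 2 * b) ≤ (X7 ^ a * G7 ^ b).comap toAlg7.toLinearMap := by
    refine Submodule.span_le.2 ?_
    rintro _ ⟨l, hl, hw, rfl⟩
    obtain ⟨a', b', hl', hw', hm⟩ := toAlg7_prod_mem l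
    obtain rfl : a' = a := by omega
    obtain rfl : b' = b := by omega
    exact hm
  exact this hz

theorem Bpw_eq_bot {p w : ℕ} (h : w < p ∨ 2 * p < w) : Bpw p w = ⊥ := by
  rw [eq_bot_iff]
  refine Submodule.span_le.2 ?_
  rintro _ ⟨l, hl, hw, rfl⟩
  obtain ⟨a, b, hl', hw', -⟩ := toAlg7_prod_mem l
  omega

/-- The family `v` spans the bidegree `(p, w)` part of `B` modulo the relations. -/
def Generates7 {k : ℕ} (p w : ℕ) (v : Fin k → Lam7) : Prop :=
  ∀ z ∈ Bpw p w, ∃ c : Fin k → ℚ, z - ∑ i, c i • v i ∈ idl7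

theorem generates7_of_le {a b k : ℕ} {u : Fin k → Alg7} {v : Fin k → Lam7}
    (h : X7 ^ a * G7 ^ b ≤ Submodule.span ℚ (Set.range u)) (huv : ∀ i, u i = toAlg7 (v i)) :
    Generates7 (a + b) (a + 2 * b) v := by
  intro z hz
  obtain ⟨c, hc⟩ := (Submodule.mem_span_range_iff_exists_fun ℚ).1 (h (toAlg7_mem_of_mem_Bpw hz))
  refine ⟨c, toAlg7_eq_iff.1 ?_⟩
  rw [← hc, map_sum]
  simp only [map_smul, huv]

theorem generates7_of_eq_bot {a b : ℕ} (h : X7 ^ a * G7 ^ b = ⊥) :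
    Generates7 (a + b) (a + 2 * b) ![] :=
  generates7_of_le (u := ![]) (by rw [h]; exact bot_le) (fun i => i.elim0)

theorem generates7_of_bidegree {p w : ℕ} (h : w < p ∨ 2 * p < w) : Generates7 p w ![] := by
  intro z hz
  rw [Bpw_eq_bot h, Submodule.mem_bot] at hz
  exact ⟨0, by simp [hz]⟩

theorem mul_mem_Bpw {p q w w' : ℕ} {a b : Lam7} (ha : a ∈ Bpw p w) (hb : b ∈ Bpw q w') :
    a * b ∈ Bpw (p + q) (w + w') := by
  have : Bpw p w * Bpw q w' ≤ Bpw (p + q) (w + w') := by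
    unfold Bpw
    rw [Submodule.span_mul_span]
    refine Submodule.span_mono ?_
    rintro _ ⟨_, ⟨l, hl, hw, rfl⟩, _, ⟨l', hl', hw', rfl⟩, rfl⟩
    exact ⟨l ++ l', by simp [hl, hl'], by simp [hw, hw'], by simp⟩
  exact this (Submodule.mul_mem_mul ha hb)

theorem e7_mem_Bpw {i : Fin 7} {w : ℕ} (h : wt7 i = w) : e7 i ∈ Bpw 1 w :=
  Submodule.subset_span ⟨[i], by simp [h]⟩

theorem e7_mul_e7_mem_Bpw {i j : Fin 7} {w : ℕ} (h : wt7 i + wt7 j = w) :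
    e7 i * e7 j ∈ Bpw 2 w :=
  Submodule.subset_span ⟨[i, j], by simp [h]⟩

theorem e7_mul_e7_mul_e7_mem_Bpw {i j k : Fin 7} {w : ℕ} (h : wt7 i + (wt7 j + wt7 k) = w) :
    e7 i * (e7 j * e7 k) ∈ Bpw 3 w :=
  Submodule.subset_span ⟨[i, j, k], by simp [h]⟩

/-! ### The differential -/

section Differential

variable {d : Lam7 →ₗ[ℚ] Lam7}

theorem IsDiff7.map_one (hd : IsDiff7 d) : d 1 = 0 := by
  have := hd.1 1 1
  simpa using this

theorem IsDiff7.map_e7_mul (hd : IsDiff7 d) (i : Fin 7) (z : Lam7) :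
    d (e7 i * z) = d (e7 i) * z - e7 i * d z := by
  rw [hd.1, sigma7, e7, ι, CliffordAlgebra.involute_ι, neg_mul, ← sub_eq_add_neg]

theorem IsDiff7.map_e7_mem (hd : IsDiff7 d) (i : Fin 7) : d (e7 i) ∈ Bpw 2 (wt7 i) := by
  obtain ⟨-, h0, h1, h2, h3, h4, h5, h6⟩ := hd
  fin_cases i
  · simp [h0]
  · simp [h1]
  · simp [h2]
  · simp [h3]
  · change d (e7 4) ∈ Bpw 2 2
    rw [h4]
    exact e7_mul_e7_mem_Bpw rfl
  · change d (e7 5) ∈ Bpw 2 2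
    rw [h5]
    exact e7_mul_e7_mem_Bpw rfl
  · change d (e7 6) ∈ Bpw 2 2
    rw [h6]
    exact add_mem (sub_mem (sub_mem (e7_mul_e7_mem_Bpw rfl) (e7_mul_e7_mem_Bpw rfl))
      (e7_mul_e7_mem_Bpw rfl)) (e7_mul_e7_mem_Bpw rfl)

theorem IsDiff7.map_Bpw_le (hd : IsDiff7 d) (p w : ℕ) : (Bpw p w).map d ≤ Bpw (p + 1) w := by
  rw [Submodule.map_le_iff_le_comap]
  refine Submodule.span_le.2 ?_
  rintro _ ⟨l, rfl, rfl, rfl⟩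
  simp only [SetLike.mem_coe, Submodule.mem_comap]
  induction l with
  | nil => simp [hd.map_one]
  | cons i l ih =>
    simp only [List.map_cons, List.prod_cons, List.sum_cons, List.length_cons]
    rw [hd.map_e7_mul]
    refine sub_mem ?_ ?_
    · rw [show l.length + 1 + 1 = 2 + l.length by ring]
      exact mul_mem_Bpw (hd.map_e7_mem i) (Submodule.subset_span ⟨l, rfl, rfl, rfl⟩)
    · rw [show l.length + 1 + 1 = 1 + (l.length + 1) by ring]
      exact mul_mem_Bpw (e7_mem_Bpw rfl) ih

/-- The bidegree `(p, w)` part of `d B`. -/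
noncomputable def bdry7 (d : Lam7 →ₗ[ℚ] Lam7) : ℕ → ℕ → Submodule ℚ Lam7
  | 0, _ => ⊥
  | p + 1, w => (Bpw p w).map d

theorem Bdpw_eq_map_bdry7 (hdi : ∀ x ∈ idl7, d x ∈ idl7) (p w : ℕ) :
    Bdpw d hdi p w = (bdry7 d p w).map idl7.mkQ := by
  cases p with
  | zero => simp [Bdpw, bdry7]
  | succ p =>
    simp only [Bdpw, bdry7, Apw]
    rw [← Submodule.map_comp, ← Submodule.map_comp]
    rfl

/-- Dimension count for the cohomology in bidegree `(p, w)` by means of a linear map `F` that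
vanishes on boundaries. -/
theorem hdimpw_eq {k n p w : ℕ} (hdi : ∀ x ∈ idl7, d x ∈ idl7) {v : Fin k → Lam7}
    (hv : Generates7 p w v) (hvB : ∀ i, v i ∈ Bpw p w)
    (F : Lam7 →ₗ[ℚ] Fin n → ℚ) (hI : ∀ x ∈ idl7, F x = 0) (hB : ∀ x ∈ bdry7 d p w, F x = 0)
    (hsurj : ∀ j, ∃ c : Fin k → ℚ, d (∑ i, c i • v i) ∈ idl7 ∧
      F (∑ i, c i • v i) = Pi.single j 1)
    (hker : ∀ c : Fin k → ℚ, d (∑ i, c i • v i) ∈ idl7 → F (∑ i, c i • v i) = 0 →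
      ∃ y ∈ bdry7 d p w, ∑ i, c i • v i - y ∈ idl7) :
    hdimpw d hdi p w = n := by
  let Fbar : (Lam7 ⧸ idl7) →ₗ[ℚ] Fin n → ℚ := idl7.liftQ F hI
  have hFbar : ∀ x, Fbar (idl7.mkQ x) = F x := fun x => idl7.liftQ_apply F x
  have hdbar : ∀ x, dbar7 d hdi (idl7.mkQ x) = idl7.mkQ (d x) := fun x => rfl
  let f := Fbar.comp (Zpw d hdi p w).subtype
  have hf : Function.Surjective f := by
    rw [← LinearMap.range_eq_top, eq_top_iff, ← (Pi.basisFun ℚ (Fin n)).span_eq]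
    refine Submodule.span_le.2 ?_
    rintro _ ⟨j, rfl⟩
    obtain ⟨c, hc, hF⟩ := hsurj j
    refine ⟨⟨idl7.mkQ (∑ i, c i • v i), ⟨_, sum_mem fun i _ => Submodule.smul_mem _ _ (hvB i), rfl⟩,
      ?_⟩, ?_⟩
    · rw [SetLike.mem_coe, LinearMap.mem_ker, hdbar, Submodule.mkQ_apply,
        Submodule.Quotient.mk_eq_zero]
      exact hc
    · simpa [f] using (hFbar _).trans hF
  have hker' : LinearMap.ker f = (Bdpw d hdi p w).comap (Zpw d hdi p w).subtype := by
    rw [Bdpw_eq_map_bdry7]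
    ext ⟨z, hzA, hzd⟩
    simp only [LinearMap.mem_ker, f, LinearMap.comp_apply, Submodule.subtype_apply,
      Submodule.mem_comap]
    constructor
    · intro hz
      obtain ⟨x, hx, rfl⟩ := hzA
      obtain ⟨c, hc⟩ := hv x hx
      have hxc : idl7.mkQ x = idl7.mkQ (∑ i, c i • v i) := (Submodule.Quotient.eq _).2 hc
      rw [hxc] at hz hzd ⊢
      rw [SetLike.mem_coe, LinearMap.mem_ker, hdbar, Submodule.mkQ_apply,
        Submodule.Quotient.mk_eq_zero] at hzd
      obtain ⟨y, hy, hyc⟩ := hker c hzd ((hFbar _).symm.trans hz)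
      exact ⟨y, hy, ((Submodule.Quotient.eq _).2 hyc).symm⟩
    · rintro ⟨y, hy, rfl⟩
      rw [hFbar, hB y hy]
  rw [hdimpw, ← hker', (f.quotKerEquivOfSurjective hf).finrank_eq]
  simp

theorem hdimpw_eq_zero {k p w : ℕ} (hdi : ∀ x ∈ idl7, d x ∈ idl7) {v : Fin k → Lam7}
    (hv : Generates7 p w v) (hvB : ∀ i, v i ∈ Bpw p w)
    (hker : ∀ c : Fin k → ℚ, d (∑ i, c i • v i) ∈ idl7 →
      ∃ y ∈ bdry7 d p w, ∑ i, c i • v i - y ∈ idl7) :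
    hdimpw d hdi p w = 0 :=
  hdimpw_eq hdi hv hvB 0 (fun _ _ => rfl) (fun _ _ => rfl) (fun j => j.elim0)
    (fun c hc _ => hker c hc)

theorem hdimpw_eq_zero_of_generates7 {p w : ℕ} (hdi : ∀ x ∈ idl7, d x ∈ idl7)
    (hv : Generates7 p w ![]) : hdimpw d hdi p w = 0 :=
  hdimpw_eq_zero hdi hv (fun i => i.elim0) (fun c _ => ⟨0, zero_mem _, by simp⟩)

theorem map_eq_zero_of_mem_bdry7 {M : Type*} [AddCommGroup M] [Module ℚ M] {k p w : ℕ}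
    (hdi : ∀ x ∈ idl7, d x ∈ idl7) {v : Fin k → Lam7} (hv : Generates7 p w v)
    (F : Lam7 →ₗ[ℚ] M) (hI : ∀ x ∈ idl7, F x = 0) (hF : ∀ i, F (d (v i)) = 0) :
    ∀ x ∈ bdry7 d (p + 1) w, F x = 0 := by
  rintro _ ⟨y, hy, rfl⟩
  obtain ⟨c, hc⟩ := hv y hy
  have := hI _ (hdi _ hc)
  rw [map_sub, map_sub, sub_eq_zero] at this
  rw [this, map_sum, map_sum]
  simp [hF]

end Differential

/-! ### Coefficient functionals -/

/-- The coefficient of the monomial with the given list of indices. -/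
noncomputable def coef7 : List (Fin 7) → Lam7 →ₗ[ℚ] ℚ
  | [] => (algebraMapInv (R := ℚ) (M := Fin 7 → ℚ)).toLinearMap
  | i :: l => coef7 l ∘ₗ CliffordAlgebra.contractLeft (LinearMap.proj i)

/-- The endomorphism of `B` sending each generator to a generator or to zero. -/
noncomputable def subst7 (s : Fin 7 → Option (Fin 7)) : Lam7 →ₐ[ℚ] Lam7 :=
  ExteriorAlgebra.map
    ((Pi.basisFun ℚ (Fin 7)).constr ℚ fun i => (s i).elim 0 fun j => Pi.single j 1)

theorem subst7_e7 (s : Fin 7 → Option (Fin 7)) (i : Fin 7) :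
    subst7 s (e7 i) = (s i).elim 0 e7 := by
  rw [subst7, e7, map_apply_ι, ← Pi.basisFun_apply, Module.Basis.constr_basis]
  cases s i <;> simp [e7]

theorem contractLeft_e7 (i j : Fin 7) :
    CliffordAlgebra.contractLeft (LinearMap.proj i) (e7 j) = if i = j then (1 : Lam7) else 0 := by
  rw [e7, ι, CliffordAlgebra.contractLeft_ι]
  by_cases h : i = j <;> simp [h]

theorem contractLeft_e7_mul (i j : Fin 7) (z : Lam7) :
    CliffordAlgebra.contractLeft (LinearMap.proj i) (e7 j * z) =
      (if i = j then z else 0) - e7 j * CliffordAlgebra.contractLeft (LinearMap.proj i) z := by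
  rw [e7, ι, CliffordAlgebra.contractLeft_ι_mul]
  by_cases h : i = j <;> simp [h]

theorem coef7_nil_one : coef7 [] 1 = 1 := by simp [coef7]

theorem coef7_cons (i : Fin 7) (l : List (Fin 7)) (z : Lam7) :
    coef7 (i :: l) z = coef7 l (CliffordAlgebra.contractLeft (LinearMap.proj i) z) := rfl

/-- The coefficient of a monomial after the substitution `s`. -/
noncomputable def cf7 (s : Fin 7 → Option (Fin 7)) (l : List (Fin 7)) : Lam7 →ₗ[ℚ] ℚ :=
  coef7 l ∘ₗ (subst7 s).toLinearMap

theorem cf7_apply (s : Fin 7 → Option (Fin 7)) (l : List (Fin 7)) (z : Lam7) :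
    cf7 s l z = coef7 l (subst7 s z) := rfl

/-- The substitution killing `g₁, g₂, g₃`. -/
def substX : Fin 7 → Option (Fin 7) := ![some 0, some 1, some 2, some 3, none, none, none]

/-- The substitution killing all generators except `x₁, y₁, g₂`. -/
def substG₂ : Fin 7 → Option (Fin 7) := ![some 0, some 1, none, none, none, some 5, none]

/-- The substitution killing `g₁, g₂` and identifying `x₂, y₂` with `x₁, y₁`. -/
def substG₃ : Fin 7 → Option (Fin 7) := ![some 0, some 1, some 0, some 1, none, none, some 6]

theorem cf7_eq_zero {s : Fin 7 → Option (Fin 7)} (hs : ∀ r ∈ rels7, subst7 s r = 0)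
    (l : List (Fin 7)) : ∀ x ∈ idl7, cf7 s l x = 0 := fun x hx => by
  simp [cf7, map_eq_zero_of_mem_idl7 _ hs hx]

theorem cf7_substX (l : List (Fin 7)) : ∀ x ∈ idl7, cf7 substX l x = 0 :=
  cf7_eq_zero (by simp [rels7, subst7_e7, substX]) l

theorem cf7_substG₂ (l : List (Fin 7)) : ∀ x ∈ idl7, cf7 substG₂ l x = 0 :=
  cf7_eq_zero (by simp [rels7, subst7_e7, substG₂]) l

theorem cf7_substG₃ (l : List (Fin 7)) : ∀ x ∈ idl7, cf7 substG₃ l x = 0 :=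
  cf7_eq_zero (by simp [rels7, subst7_e7, substG₃]) l

/-! ### The bigraded cohomology -/

theorem e7_swap_of_lt {i j : Fin 7} (_ : i < j) : e7 j * e7 i = -(e7 i * e7 j) := e7_swap j i

theorem e7_swap_mul_of_lt {i j : Fin 7} (_ : i < j) (z : Lam7) :
    e7 j * (e7 i * z) = -(e7 i * (e7 j * z)) := by
  rw [← mul_assoc, e7_swap, neg_mul, mul_assoc]

theorem e7_sq_mul (i : Fin 7) (z : Lam7) : e7 i * (e7 i * z) = 0 := by
  rw [← mul_assoc, e7_sq, zero_mul]

theorem generates7_zero_zero : Generates7 0 0 ![1] :=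
  generates7_of_le (a := 0) (b := 0) (u := ![1]) (by
      rw [pow_zero, pow_zero, one_mul, Submodule.one_eq_span]; simp)
    (by simp)

theorem generates7_one_one : Generates7 1 1 ![e7 0, e7 1, e7 2, e7 3] :=
  generates7_of_le (a := 1) (b := 0) (by rw [pow_one, pow_zero, mul_one, X7])
    (fun i => by fin_cases i <;> rfl)

theorem generates7_two_two : Generates7 2 2 ![e7 0 * e7 1, e7 0 * e7 2, e7 0 * e7 3,
    e7 1 * e7 2, e7 1 * e7 3, e7 2 * e7 3] :=
  generates7_of_le (a := 2) (b := 0) (by rw [pow_zero, mul_one]; exact X7_pow_two_le)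
    (fun i => by fin_cases i <;> simp [toAlg7_e7])

theorem generates7_three_three : Generates7 3 3 ![e7 0 * (e7 1 * e7 2), e7 0 * (e7 1 * e7 3),
    e7 0 * (e7 2 * e7 3), e7 1 * (e7 2 * e7 3)] :=
  generates7_of_le (a := 3) (b := 0) (by rw [pow_zero, mul_one]; exact X7_pow_three_le)
    (fun i => by fin_cases i <;> simp [toAlg7_e7])

theorem generates7_four_four : Generates7 4 4 ![e7 0 * (e7 1 * (e7 2 * e7 3))] :=
  generates7_of_le (a := 4) (b := 0) (by rw [pow_zero, mul_one]; exact X7_pow_four_le)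
    (fun i => by fin_cases i; simp [toAlg7_e7])

theorem generates7_one_two : Generates7 1 2 ![e7 4, e7 5, e7 6] :=
  generates7_of_le (a := 0) (b := 1) (by rw [pow_one, pow_zero, one_mul, G7])
    (fun i => by fin_cases i <;> rfl)

theorem generates7_two_three : Generates7 2 3 ![e7 2 * e7 4, e7 3 * e7 4, e7 0 * e7 5,
    e7 1 * e7 5, e7 0 * e7 6, e7 1 * e7 6] :=
  generates7_of_le (a := 1) (b := 1) (by rw [pow_one, pow_one]; exact X7_mul_G7_le)
    (fun i => by fin_cases i <;> simp [toAlg7_e7])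

theorem generates7_three_four : Generates7 3 4
    ![e7 2 * (e7 3 * e7 4), e7 0 * (e7 1 * e7 5), e7 0 * (e7 1 * e7 6)] :=
  generates7_of_le (a := 2) (b := 1) (by rw [pow_one]; exact X7_pow_two_mul_G7_le)
    (fun i => by fin_cases i <;> simp [toAlg7_e7])

theorem generates7_two_four : Generates7 2 4 ![e7 4 * e7 5, e7 4 * e7 6] :=
  generates7_of_le (a := 0) (b := 2) (by rw [pow_zero, one_mul]; exact G7_pow_two_le)
    (fun i => by fin_cases i <;> simp [toAlg7_e7])

section Cohomology

variable {d : Lam7 →ₗ[ℚ] Lam7}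

theorem hdimpw_zero_zero (hd : IsDiff7 d) (hdi : ∀ x ∈ idl7, d x ∈ idl7) :
    hdimpw d hdi 0 0 = 1 := by
  refine hdimpw_eq hdi generates7_zero_zero (fun i => ?_)
    (LinearMap.pi ![cf7 substX []]) (fun x hx => ?_) ?_ ?_ ?_
  · exact Submodule.subset_span ⟨[], by simp⟩
  · ext j
    fin_cases j
    simp [cf7_substX _ x hx]
  · simp [bdry7]
  · intro j
    refine ⟨fun _ => 1, by simp [hd.map_one], ?_⟩
    ext i
    fin_cases i; fin_cases j
    simp [cf7_apply, coef7_nil_one]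
  · intro c _ hF
    have := congrFun hF 0
    simp [cf7_apply, coef7_nil_one] at this
    exact ⟨0, zero_mem _, by simp [this]⟩

theorem hdimpw_one_one (hd : IsDiff7 d) (hdi : ∀ x ∈ idl7, d x ∈ idl7) :
    hdimpw d hdi 1 1 = 4 := by
  obtain ⟨-, h0, h1, h2, h3, -⟩ := id hd
  refine hdimpw_eq hdi generates7_one_one (fun i => ?_)
    (LinearMap.pi ![cf7 substX [0], cf7 substX [1], cf7 substX [2], cf7 substX [3]])
    (fun x hx => ?_) ?_ ?_ ?_
  · fin_cases i <;> dsimp <;> exact e7_mem_Bpw rfl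
  · ext j
    fin_cases j <;> simp [cf7_substX _ x hx]
  · exact map_eq_zero_of_mem_bdry7 hdi (generates7_of_bidegree (by simp)) _
      (fun x hx => by ext j; fin_cases j <;> simp [cf7_substX _ x hx]) (fun i => i.elim0)
  · intro j
    refine ⟨Pi.single j 1, by fin_cases j <;> simp [h0, h1, h2, h3], ?_⟩
    ext i
    fin_cases i <;> fin_cases j <;>
      simp [cf7_apply, coef7_cons, coef7_nil_one, subst7_e7, substX, contractLeft_e7]
  · intro c _ hF
    have H := fun j => congrFun hF j
    simp [Fin.forall_fin_succ, Fin.sum_univ_succ, cf7_apply, coef7_cons, coef7_nil_one, subst7_e7,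
      substX,
      contractLeft_e7] at H
    obtain ⟨H0, H1, H2, H3⟩ := H
    exact ⟨0, zero_mem _, by simp [Fin.sum_univ_succ, H0, H1, H2, H3]⟩

theorem hdimpw_one_two (hd : IsDiff7 d) (hdi : ∀ x ∈ idl7, d x ∈ idl7) :
    hdimpw d hdi 1 2 = 0 := by
  obtain ⟨-, h0, h1, h2, h3, h4, h5, h6⟩ := id hd
  refine hdimpw_eq_zero hdi generates7_one_two (fun i => ?_) ?_
  · fin_cases i <;> dsimp <;> exact e7_mem_Bpw rfl
  · intro c hc
    have H1 := cf7_substX [0, 1] _ hc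
    have H2 := cf7_substX [2, 3] _ hc
    have H3 := cf7_substX [0, 3] _ hc
    simp [Fin.sum_univ_succ, h4, h5, h6, cf7_apply, coef7_cons, coef7_nil_one, subst7_e7, substX,
      contractLeft_e7,
      contractLeft_e7_mul] at H1 H2 H3
    simp [H3] at H1 H2
    exact ⟨0, zero_mem _, by simp [Fin.sum_univ_succ, H1, H2, H3]⟩

theorem hdimpw_two_two (hd : IsDiff7 d) (hdi : ∀ x ∈ idl7, d x ∈ idl7) :
    hdimpw d hdi 2 2 = 3 := by
  obtain ⟨-, h0, h1, h2, h3, h4, h5, h6⟩ := id hd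
  have hI : ∀ x ∈ idl7, LinearMap.pi ![cf7 substX [0, 2], cf7 substX [1, 3],
      cf7 substX [0, 3] + cf7 substX [1, 2]] x = 0 := by
    intro x hx
    ext j
    fin_cases j <;> simp [cf7_substX _ x hx]
  refine hdimpw_eq hdi generates7_two_two (fun i => ?_) _ hI
    (map_eq_zero_of_mem_bdry7 hdi generates7_one_two _ hI ?_) ?_ ?_
  · fin_cases i <;> dsimp <;> exact e7_mul_e7_mem_Bpw rfl
  · intro i
    ext j
    fin_cases i <;> fin_cases j <;>
      simp [h4, h5, h6, cf7_apply, coef7_cons, coef7_nil_one, subst7_e7, substX, contractLeft_e7,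
        contractLeft_e7_mul]
  · intro j
    refine ⟨![![0, 1, 0, 0, 0, 0], ![0, 0, 0, 0, 1, 0], ![0, 0, 1, 0, 0, 0]] j, ?_, ?_⟩
    · simp [Fin.sum_univ_succ, hd.map_e7_mul, h0, h1, h2, h3]
    · ext i
      fin_cases i <;> fin_cases j <;>
        simp [Fin.sum_univ_succ, cf7_apply, coef7_cons, coef7_nil_one, subst7_e7, substX,
          contractLeft_e7,
          contractLeft_e7_mul]
  · intro c _ hF
    have H := fun j => congrFun hF j
    simp [Fin.forall_fin_succ, Fin.sum_univ_succ, cf7_apply, coef7_cons, coef7_nil_one, subst7_e7,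
      substX,
      contractLeft_e7, contractLeft_e7_mul] at H
    obtain ⟨H0, H1, H2⟩ := H
    rw [← eq_neg_iff_add_eq_zero] at H2
    refine ⟨d ((c 0 + c 2) • e7 4 + (c 5 + c 2) • e7 5 - c 2 • e7 6), Submodule.mem_map_of_mem ?_,
      ?_⟩
    · exact sub_mem (add_mem (Submodule.smul_mem _ _ (e7_mem_Bpw rfl))
        (Submodule.smul_mem _ _ (e7_mem_Bpw rfl))) (Submodule.smul_mem _ _ (e7_mem_Bpw rfl))
    · have : ∑ i, c i • ![e7 0 * e7 1, e7 0 * e7 2, e7 0 * e7 3, e7 1 * e7 2, e7 1 * e7 3,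
          e7 2 * e7 3] i - d ((c 0 + c 2) • e7 4 + (c 5 + c 2) • e7 5 - c 2 • e7 6) = 0 := by
        simp [Fin.sum_univ_succ, h4, h5, h6, H0, H1, H2, e7_swap_of_lt]
        module
      rw [this]
      exact zero_mem _

theorem hdimpw_two_three (hd : IsDiff7 d) (hdi : ∀ x ∈ idl7, d x ∈ idl7) :
    hdimpw d hdi 2 3 = 2 := by
  obtain ⟨-, h0, h1, h2, h3, h4, h5, h6⟩ := id hd
  have hI : ∀ x ∈ idl7, LinearMap.pi ![cf7 substG₃ [0, 6], cf7 substG₃ [1, 6]] x = 0 := by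
    intro x hx
    ext j
    fin_cases j <;> simp [cf7_substG₃ _ x hx]
  refine hdimpw_eq hdi generates7_two_three (fun i => ?_) _ hI
    (map_eq_zero_of_mem_bdry7 hdi (generates7_of_bidegree (by simp)) _ hI (fun i => i.elim0)) ?_ ?_
  · fin_cases i <;> dsimp <;> exact e7_mul_e7_mem_Bpw rfl
  · intro j
    refine ⟨![![-1, 0, -1, 0, 1, 0], ![0, -1, 0, -1, 0, 1]] j, ?_, ?_⟩
    · fin_cases j <;>
      simp [Fin.sum_univ_succ, hd.map_e7_mul, h0, h1, h2, h3, h4, h5, h6, mul_sub, mul_add,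
        e7_swap_of_lt, e7_swap_mul_of_lt, e7_sq, e7_sq_mul]
    · ext i
      fin_cases i <;> fin_cases j <;>
        simp [Fin.sum_univ_succ, cf7_apply, coef7_cons, coef7_nil_one, subst7_e7, substG₃,
          contractLeft_e7,
          contractLeft_e7_mul]
  · intro c hc hF
    have H := fun j => congrFun hF j
    simp [Fin.forall_fin_succ, Fin.sum_univ_succ, cf7_apply, coef7_cons, coef7_nil_one, subst7_e7,
      substG₃,
      contractLeft_e7, contractLeft_e7_mul] at H
    obtain ⟨H4, H5⟩ := H
    have H0 := cf7_substX [0, 1, 2] _ hc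
    have H1 := cf7_substX [0, 1, 3] _ hc
    have H2 := cf7_substX [0, 2, 3] _ hc
    have H3 := cf7_substX [1, 2, 3] _ hc
    simp [Fin.sum_univ_succ, hd.map_e7_mul, h0, h1, h2, h3, h4, h5, H4, H5, cf7_apply, coef7_cons,
      coef7_nil_one,
      subst7_e7, substX, contractLeft_e7, contractLeft_e7_mul] at H0 H1 H2 H3
    exact ⟨0, zero_mem _, by simp [Fin.sum_univ_succ, H0, H1, H2, H3, H4, H5]⟩

theorem hdimpw_two_four (hd : IsDiff7 d) (hdi : ∀ x ∈ idl7, d x ∈ idl7) :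
    hdimpw d hdi 2 4 = 0 := by
  obtain ⟨-, h0, h1, h2, h3, h4, h5, h6⟩ := id hd
  refine hdimpw_eq_zero hdi generates7_two_four (fun i => ?_) ?_
  · fin_cases i <;> dsimp <;> exact e7_mul_e7_mem_Bpw rfl
  · intro c hc
    have H0 := cf7_substG₂ [0, 1, 5] _ hc
    have H1 := cf7_substG₃ [0, 1, 6] _ hc
    simp [Fin.sum_univ_succ, hd.map_e7_mul, h4, h5, h6, cf7_apply, coef7_cons, coef7_nil_one,
      mul_assoc,
      subst7_e7, substG₂, contractLeft_e7, contractLeft_e7_mul] at H0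
    simp [Fin.sum_univ_succ, hd.map_e7_mul, h4, h5, h6, cf7_apply, coef7_cons, coef7_nil_one,
      mul_assoc,
      subst7_e7, substG₃, contractLeft_e7, contractLeft_e7_mul] at H1
    exact ⟨0, zero_mem _, by simp [Fin.sum_univ_succ, H0, H1]⟩

theorem hdimpw_three_three (hd : IsDiff7 d) (hdi : ∀ x ∈ idl7, d x ∈ idl7) :
    hdimpw d hdi 3 3 = 0 := by
  obtain ⟨-, h0, h1, h2, h3, h4, h5, h6⟩ := id hd
  refine hdimpw_eq_zero hdi generates7_three_three (fun i => ?_) ?_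
  · fin_cases i <;> dsimp <;> exact e7_mul_e7_mul_e7_mem_Bpw rfl
  · intro c _
    refine ⟨d (-(c 0 • (e7 2 * e7 4) + c 1 • (e7 3 * e7 4) + c 2 • (e7 0 * e7 5) +
      c 3 • (e7 1 * e7 5))), Submodule.mem_map_of_mem ?_, ?_⟩
    · exact neg_mem (add_mem (add_mem (add_mem
        (Submodule.smul_mem _ _ (e7_mul_e7_mem_Bpw rfl))
        (Submodule.smul_mem _ _ (e7_mul_e7_mem_Bpw rfl)))
        (Submodule.smul_mem _ _ (e7_mul_e7_mem_Bpw rfl)))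
        (Submodule.smul_mem _ _ (e7_mul_e7_mem_Bpw rfl)))
    · have : ∑ i, c i • ![e7 0 * (e7 1 * e7 2), e7 0 * (e7 1 * e7 3), e7 0 * (e7 2 * e7 3),
          e7 1 * (e7 2 * e7 3)] i - d (-(c 0 • (e7 2 * e7 4) + c 1 • (e7 3 * e7 4) +
          c 2 • (e7 0 * e7 5) + c 3 • (e7 1 * e7 5))) = 0 := by
        simp [Fin.sum_univ_succ, hd.map_e7_mul, h0, h1, h2, h3, h4, h5, e7_swap_of_lt,
          e7_swap_mul_of_lt]
        module
      rw [this]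
      exact zero_mem _

theorem hdimpw_three_four (hd : IsDiff7 d) (hdi : ∀ x ∈ idl7, d x ∈ idl7) :
    hdimpw d hdi 3 4 = 0 := by
  obtain ⟨-, h0, h1, h2, h3, h4, h5, h6⟩ := id hd
  refine hdimpw_eq_zero hdi generates7_three_four (fun i => ?_) ?_
  · fin_cases i <;> dsimp <;> exact e7_mul_e7_mul_e7_mem_Bpw rfl
  · intro c hc
    have H := cf7_substX [0, 1, 2, 3] _ hc
    simp [Fin.sum_univ_succ, hd.map_e7_mul, h0, h1, h2, h3, h4, h5, h6, cf7_apply, coef7_cons,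
      coef7_nil_one,
      subst7_e7, substX, contractLeft_e7, contractLeft_e7_mul] at H
    refine ⟨d (c 1 • (e7 4 * e7 5) + c 2 • (e7 4 * e7 6)), Submodule.mem_map_of_mem ?_, ?_⟩
    · exact add_mem (Submodule.smul_mem _ _ (e7_mul_e7_mem_Bpw rfl))
        (Submodule.smul_mem _ _ (e7_mul_e7_mem_Bpw rfl))
    · rw [← toAlg7_eq_zero_iff]
      rw [← eq_neg_iff_add_eq_zero] at H
      simp [Fin.sum_univ_succ, hd.map_e7_mul, h4, h5, h6, H, toAlg7_e7, mul_assoc, mul_add,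
        mul_sub, t7_swap_of_lt, t7_swap_mul_of_lt, t7_one_four, t7_mul_mul_eq_zero t7_zero_four,
        t7_mul_mul_eq_zero t7_one_four]
      module

theorem hdimpw_four_four (hd : IsDiff7 d) (hdi : ∀ x ∈ idl7, d x ∈ idl7) :
    hdimpw d hdi 4 4 = 0 := by
  obtain ⟨-, h0, h1, h2, h3, h4, h5, h6⟩ := id hd
  refine hdimpw_eq_zero hdi generates7_four_four (fun i => ?_) ?_
  · fin_cases i
    exact Submodule.subset_span ⟨[0, 1, 2, 3], rfl, rfl, by simp⟩
  · intro c _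
    refine ⟨d (c 0 • (e7 2 * (e7 3 * e7 4))), Submodule.mem_map_of_mem ?_, ?_⟩
    · exact Submodule.smul_mem _ _ (e7_mul_e7_mul_e7_mem_Bpw rfl)
    · simp [hd.map_e7_mul, h2, h3, h4, e7_swap_of_lt, e7_swap_mul_of_lt]

end Cohomology

/-- With `x_i, y_i` of bidegree `(1,1)` and `g_i` of bidegree `(1,2)`, the
differential is homogeneous of cohomological degree `+1` and weight `0`, and the
two-variable Hilbert series of `H*(A,d)` is `H(t,u) = 1 + 4tu + 3t²u² + 2t²u³`. -/
theorem mixed_hodge_numbers_elliptic (d : Lam7 →ₗ[ℚ] Lam7) (hd : IsDiff7 d)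
    (hdi : ∀ x ∈ idl7, d x ∈ idl7) :
    (∀ p w : ℕ, Submodule.map (dbar7 d hdi) (Apw p w) ≤ Apw (p + 1) w) ∧
    ∀ p w : ℕ, hdimpw d hdi p w =
      if p = 0 ∧ w = 0 then 1
      else if p = 1 ∧ w = 1 then 4
      else if p = 2 ∧ w = 2 then 3
      else if p = 2 ∧ w = 3 then 2
      else 0 := by
  refine ⟨fun p w => ?_, fun p w => ?_⟩
  · rintro _ ⟨_, ⟨x, hx, rfl⟩, rfl⟩
    exact ⟨d x, hd.map_Bpw_le p w ⟨x, hx, rfl⟩, rfl⟩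
  · by_cases h : w < p ∨ 2 * p < w
    · rw [hdimpw_eq_zero_of_generates7 hdi (generates7_of_bidegree h)]
      split_ifs <;> omega
    · obtain ⟨a, b, rfl, rfl⟩ : ∃ a b, p = a + b ∧ w = a + 2 * b :=
        ⟨2 * p - w, w - p, by omega, by omega⟩
      have hbot : X7 ^ a * G7 ^ b = ⊥ → hdimpw d hdi (a + b) (a + 2 * b) = 0 := fun h0 =>
        hdimpw_eq_zero_of_generates7 hdi (generates7_of_eq_bot h0)
      match a, b with
      | 0, 0 => exact hdimpw_zero_zero hd hdi
      | 1, 0 => exact hdimpw_one_one hd hdi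
      | 2, 0 => exact hdimpw_two_two hd hdi
      | 3, 0 => exact hdimpw_three_three hd hdi
      | 4, 0 => exact hdimpw_four_four hd hdi
      | a + 5, 0 =>
        rw [hbot (by rw [pow_add, X7_pow_five]; simp)]
        rw [if_neg (by omega), if_neg (by omega), if_neg (by omega), if_neg (by omega)]
      | 0, 1 => exact hdimpw_one_two hd hdi
      | 1, 1 => exact hdimpw_two_three hd hdi
      | 2, 1 => exact hdimpw_three_four hd hdi
      | a + 3, 1 =>
        rw [hbot (by rw [pow_add, pow_one, mul_assoc, X7_pow_three_mul_G7]; simp)]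
        rw [if_neg (by omega), if_neg (by omega), if_neg (by omega), if_neg (by omega)]
      | 0, 2 => exact hdimpw_two_four hd hdi
      | a + 1, 2 =>
        rw [hbot (by rw [pow_succ, mul_assoc, X7_mul_G7_pow_two]; simp)]
        rw [if_neg (by omega), if_neg (by omega), if_neg (by omega), if_neg (by omega)]
      | a, b + 3 =>
        rw [hbot (by rw [pow_add, G7_pow_three]; simp)]
        rw [if_neg (by omega), if_neg (by omega), if_neg (by omega), if_neg (by omega)]
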